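/- arXiv:1801.08608 — 2 statements merged into one kernel-verified Lean document; each statement's English description precedes it below -/
import Mathlib

section
/- Let 𝒜 be a semiprime uniformly complete f-algebra and let p ∈ ℕ with p ≥ 2. If g ∈ 𝒜 is such that g^p is a finite element of the product algebra Π_p(𝒜), then g is a finite element of 𝒜; moreover, if u^p (with u ∈ 𝒜₊) is a majorant of g^p in Π_p(𝒜), then u is a majorant of g in 𝒜. -/
namespace FiniteElementsPaper

/-- Product of `p` factors `φ 0 * φ 1 * ⋯ * φ (p-1)` in a (possibly non-unital)
multiplicative structure; junk value `0` when `p = 0`. -/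
def mulProd {A : Type*} [Mul A] [Zero A] : (p : ℕ) → (Fin p → A) → A
  | 0, _ => 0
  | q + 1, φ => Fin.foldl q (fun acc i => acc * φ i.succ) (φ 0)

/-- `p`-th power `a^p` (junk value `0` for `p = 0`). -/
def mpow {A : Type*} [Mul A] [Zero A] (a : A) (p : ℕ) : A :=
  mulProd p (fun _ => a)

/-- The set `Π_p(𝒜)` of all `p`-fold products. -/
def piSet (A : Type*) [Mul A] [Zero A] (p : ℕ) : Set A :=
  {x | ∃ φ : Fin p → A, x = mulProd p φ}

variable {A : Type*} [Lattice A] [AddCommGroup A] [Module ℝ A]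

/-- `z` is a majorant of `φ`: `z ≥ 0` and for every `x` there is `c > 0` with
`|x| ⊓ n • |φ| ≤ c • z` for all `n`. -/
def IsMajorant (z φ : A) : Prop :=
  0 ≤ z ∧ ∀ x : A, ∃ c : ℝ, 0 < c ∧ ∀ n : ℕ, |x| ⊓ n • |φ| ≤ c • z

/-- `φ` is a finite element. -/
def IsFiniteElt (φ : A) : Prop := ∃ z : A, IsMajorant z φ

/-- `φ` is a totally finite element: it has a majorant which is itself finite. -/
def IsTotallyFiniteElt (φ : A) : Prop := ∃ z : A, IsMajorant z φ ∧ IsFiniteElt z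

/-- `φ` is self-majorizing: `|φ|` is a majorant of `φ`. -/
def IsSelfMajorizing (φ : A) : Prop := IsMajorant |φ| φ

/-- `φ ∈ Φ₃(A) = S₊(A) - S₊(A)`. -/
def InPhi3 (φ : A) : Prop :=
  ∃ s t : A, 0 ≤ s ∧ 0 ≤ t ∧ IsSelfMajorizing s ∧ IsSelfMajorizing t ∧ φ = s - t

/-- `w` is a majorant of `φ` relative to the subset `S` (all lattice operations
computed in the ambient algebra). -/
def IsMajorantIn (S : Set A) (w φ : A) : Prop :=
  0 ≤ w ∧ ∀ x ∈ S, ∃ c : ℝ, 0 < c ∧ ∀ n : ℕ, |x| ⊓ n • |φ| ≤ c • w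

/-- `φ` is a finite element of the sublattice `S` (majorant required to lie in `S`). -/
def IsFiniteEltIn (S : Set A) (φ : A) : Prop := ∃ w ∈ S, IsMajorantIn S w φ

/-- `φ` is a totally finite element of the sublattice `S`. -/
def IsTotallyFiniteEltIn (S : Set A) (φ : A) : Prop :=
  ∃ w ∈ S, IsMajorantIn S w φ ∧ IsFiniteEltIn S w

/-- `φ` is self-majorizing in the sublattice `S`. -/
def IsSelfMajorizingIn (S : Set A) (φ : A) : Prop := IsMajorantIn S |φ| φ

/-- `φ ∈ Φ₃(S) = S₊(S) - S₊(S)` for the sublattice `S`. -/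
def InPhi3In (S : Set A) (φ : A) : Prop :=
  ∃ s t : A, s ∈ S ∧ t ∈ S ∧ 0 ≤ s ∧ 0 ≤ t ∧
    IsSelfMajorizingIn S s ∧ IsSelfMajorizingIn S t ∧ φ = s - t

variable (A) in
/-- Archimedean ℓ-algebra structure: an Archimedean vector lattice together with an
associative bilinear multiplication whose product of positive elements is positive. -/
structure IsLAlgebra [Mul A] : Prop where
  add_le_add_left : ∀ a b : A, a ≤ b → ∀ c : A, c + a ≤ c + b
  smul_le_smul : ∀ (r : ℝ) (a b : A), 0 ≤ r → a ≤ b → r • a ≤ r • b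
  archimedean : ∀ a b : A, 0 ≤ a → (∀ n : ℕ, n • a ≤ b) → a = 0
  mul_assoc : ∀ a b c : A, a * b * c = a * (b * c)
  left_distrib : ∀ a b c : A, a * (b + c) = a * b + a * c
  right_distrib : ∀ a b c : A, (a + b) * c = a * c + b * c
  smul_mul : ∀ (r : ℝ) (a b : A), (r • a) * b = r • (a * b)
  mul_smul : ∀ (r : ℝ) (a b : A), a * (r • b) = r • (a * b)
  mul_nonneg : ∀ a b : A, 0 ≤ a → 0 ≤ b → 0 ≤ a * b

variable (A) in
/-- A `d`-algebra: ℓ-algebra in which `a ⊓ b = 0` implies `(a*c) ⊓ (b*c) = (c*a) ⊓ (c*b) = 0`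
for all `c ≥ 0`. -/
structure IsDAlgebra [Mul A] extends IsLAlgebra A : Prop where
  d_prop : ∀ a b c : A, a ⊓ b = 0 → 0 ≤ c → (a * c) ⊓ (b * c) = 0 ∧ (c * a) ⊓ (c * b) = 0

variable (A) in
/-- An `f`-algebra: ℓ-algebra in which `a ⊓ b = 0` implies `(a*c) ⊓ b = (c*a) ⊓ b = 0`
for all `c ≥ 0`. -/
structure IsFAlgebra [Mul A] extends IsLAlgebra A : Prop where
  f_prop : ∀ a b c : A, a ⊓ b = 0 → 0 ≤ c → (a * c) ⊓ b = 0 ∧ (c * a) ⊓ b = 0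

/-- `e` is a multiplicative unit. -/
def IsMulUnit [Mul A] (e : A) : Prop := ∀ a : A, a * e = a ∧ e * a = a

/-- `e` is an order unit. -/
def IsOrderUnit (e : A) : Prop := 0 ≤ e ∧ ∀ x : A, ∃ l : ℝ, 0 ≤ l ∧ |x| ≤ l • e

variable (A) in
/-- The algebra is semiprime: `0` is its only nilpotent element. -/
def IsSemiprime [Mul A] [Zero A] : Prop :=
  ∀ (a : A) (n : ℕ), 0 < n → mpow a n = 0 → a = 0

variable (A) in
/-- The vector lattice is uniformly complete. -/
def UniformlyComplete : Prop :=
  ∀ u : A, 0 ≤ u → ∀ f : ℕ → A,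
    (∀ ε : ℝ, 0 < ε → ∃ K : ℕ, ∀ m n : ℕ, K ≤ m → K ≤ n → |f m - f n| ≤ ε • u) →
    ∃ a : A, ∀ ε : ℝ, 0 < ε → ∃ K : ℕ, ∀ n : ℕ, K ≤ n → |f n - a| ≤ ε • u

variable (A) in
/-- The weak factorization property: every element is dominated by a product. -/
def WeakFactorization [Mul A] : Prop := ∀ a : A, ∃ b c : A, a ≤ b * c


section mulProd

variable {M : Type*} [Mul M] [Zero M]

lemma mulProd_succ_succ (q : ℕ) (φ : Fin (q + 2) → M) :
    mulProd (q + 2) φ = mulProd (q + 1) (fun i => φ i.castSucc) * φ (Fin.last (q + 1)) := by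
  simp only [mulProd, Fin.foldl_succ_last, Fin.succ_last, Fin.succ_castSucc, Fin.castSucc_zero]

lemma mpow_one (a : M) : mpow a 1 = a := rfl

lemma mpow_succ_succ (a : M) (q : ℕ) : mpow a (q + 2) = mpow a (q + 1) * a :=
  mulProd_succ_succ q _

end mulProd

lemma add_inf_eq_zero {G : Type*} [Lattice G] [AddCommGroup G] [IsOrderedAddMonoid G]
    {x y z : G} (hx : 0 ≤ x) (hy : 0 ≤ y)
    (hxz : x ⊓ z = 0) (hyz : y ⊓ z = 0) : (x + y) ⊓ z = 0 := by
  have hz : 0 ≤ z := hxz ▸ inf_le_right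
  refine le_antisymm ?_ (le_inf (add_nonneg hx hy) hz)
  have h : (x + y) ⊓ z - x ≤ y ⊓ z :=
    le_inf (sub_le_iff_le_add'.2 inf_le_left) ((sub_le_self _ hx).trans inf_le_right)
  rw [hyz, sub_nonpos] at h
  exact hxz ▸ le_inf h inf_le_right

lemma abs_sub_of_inf_eq_zero {G : Type*} [Lattice G] [AddCommGroup G] [IsOrderedAddMonoid G]
    {x y : G} (h : x ⊓ y = 0) :
    |x - y| = x + y := by
  rw [← inf_add_sup x y, h, zero_add, ← abs_sub_comm y x, ← sup_sub_inf_eq_abs_sub, h, sub_zero]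

namespace IsFAlgebra

variable [Mul A]

protected lemma isOrderedAddMonoid (hA : IsFAlgebra A) : IsOrderedAddMonoid A where
  add_le_add_left a b h c := by simpa only [add_comm _ c] using hA.add_le_add_left a b h c

protected lemma mul_zero (hA : IsFAlgebra A) (a : A) : a * 0 = 0 := by
  simpa using hA.left_distrib a 0 0

protected lemma mul_le_mul (hA : IsFAlgebra A) {a b c d : A} (ha : 0 ≤ a) (hab : a ≤ b)
    (hc : 0 ≤ c) (hcd : c ≤ d) : a * c ≤ b * d := by
  have := hA.isOrderedAddMonoid
  obtain ⟨x, rfl⟩ : ∃ x, b = a + x := ⟨b - a, by abel⟩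
  obtain ⟨y, rfl⟩ : ∃ y, d = c + y := ⟨d - c, by abel⟩
  rw [le_add_iff_nonneg_right] at hab hcd
  rw [hA.left_distrib, hA.right_distrib, add_assoc, le_add_iff_nonneg_right]
  exact add_nonneg (hA.mul_nonneg _ _ hab hc) (hA.mul_nonneg _ _ (add_nonneg ha hab) hcd)

/-- Disjoint elements of an f-algebra have product zero. -/
lemma mul_eq_zero_of_inf_eq_zero (hA : IsFAlgebra A) {a b : A} (h : a ⊓ b = 0) : a * b = 0 := by
  have ha : 0 ≤ a := h ▸ inf_le_left
  have hb : 0 ≤ b := h ▸ inf_le_right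
  have h₁ := (hA.f_prop a b b h hb).1
  rw [inf_comm] at h₁
  simpa using (hA.f_prop b (a * b) a h₁ ha).2

protected lemma abs_mul (hA : IsFAlgebra A) (a b : A) : |a * b| = |a| * |b| := by
  have := hA.isOrderedAddMonoid
  have ha := posPart_inf_negPart_eq_zero a
  have hb := posPart_inf_negPart_eq_zero b
  have hpa := posPart_nonneg a
  have hna := negPart_nonneg a
  have hpb := posPart_nonneg b
  have hnb := negPart_nonneg b
  have hea : a = a⁺ - a⁻ := (posPart_sub_negPart a).symm
  have heb : b = b⁺ - b⁻ := (posPart_sub_negPart b).symm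
  rw [← posPart_add_negPart a, ← posPart_add_negPart b]
  generalize a⁺ = p, a⁻ = n, b⁺ = q, b⁻ = m at *
  have left {x y c d : A} (h : x ⊓ y = 0) (hc : 0 ≤ c) (hd : 0 ≤ d) : (x * c) ⊓ (y * d) = 0 := by
    have h₁ := (hA.f_prop x y c h hc).1
    rw [inf_comm] at h₁ ⊢
    exact (hA.f_prop y (x * c) d h₁ hd).1
  have right {x y c d : A} (h : x ⊓ y = 0) (hc : 0 ≤ c) (hd : 0 ≤ d) :
      (c * x) ⊓ (d * y) = 0 := by
    have h₁ := (hA.f_prop x y c h hc).2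
    rw [inf_comm] at h₁ ⊢
    exact (hA.f_prop y (c * x) d h₁ hd).2
  have ha' : n ⊓ p = 0 := inf_comm p n ▸ ha
  have hb' : m ⊓ q = 0 := inf_comm q m ▸ hb
  have hdisj : (p * q + n * m) ⊓ (p * m + n * q) = 0 := by
    have hpq := hA.mul_nonneg p q hpa hpb
    have hnm := hA.mul_nonneg n m hna hnb
    have hpm := hA.mul_nonneg p m hpa hnb
    have hnq := hA.mul_nonneg n q hna hpb
    refine add_inf_eq_zero hpq hnm ?_ ?_ <;> rw [inf_comm] <;>
      refine add_inf_eq_zero hpm hnq ?_ ?_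
    exacts [right hb' hpa hpa, left ha' hpb hpb, left ha hnb hnb, right hb hna hna]
  have hab : a * b = (p * q + n * m) - (p * m + n * q) := by
    obtain rfl : p = a + n := by rw [hea]; abel
    obtain rfl : q = b + m := by rw [heb]; abel
    simp only [hA.left_distrib, hA.right_distrib]
    abel
  rw [hab, abs_sub_of_inf_eq_zero hdisj]
  simp only [hA.left_distrib, hA.right_distrib]
  abel

lemma abs_mulProd (hA : IsFAlgebra A) (q : ℕ) (φ : Fin (q + 1) → A) :
    |mulProd (q + 1) φ| = mulProd (q + 1) (fun i => |φ i|) := by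
  induction q with
  | zero => rfl
  | succ q ih => rw [mulProd_succ_succ, mulProd_succ_succ, hA.abs_mul, ih]

lemma mulProd_nonneg (hA : IsFAlgebra A) {q : ℕ} {φ : Fin (q + 1) → A} (hφ : ∀ i, 0 ≤ φ i) :
    0 ≤ mulProd (q + 1) φ := by
  induction q with
  | zero => exact hφ 0
  | succ q ih =>
    rw [mulProd_succ_succ]
    exact hA.mul_nonneg _ _ (ih fun i => hφ _) (hφ _)

lemma mulProd_le_mulProd (hA : IsFAlgebra A) {q : ℕ} {φ ψ : Fin (q + 1) → A}
    (hφ : ∀ i, 0 ≤ φ i) (h : ∀ i, φ i ≤ ψ i) : mulProd (q + 1) φ ≤ mulProd (q + 1) ψ := by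
  induction q with
  | zero => exact h 0
  | succ q ih =>
    rw [mulProd_succ_succ, mulProd_succ_succ]
    exact hA.mul_le_mul (hA.mulProd_nonneg fun i => hφ _) (ih (fun i => hφ _) fun i => h _)
      (hφ _) (h _)

lemma mpow_smul (hA : IsFAlgebra A) (c : ℝ) (a : A) (q : ℕ) :
    mpow (c • a) (q + 1) = c ^ (q + 1) • mpow a (q + 1) := by
  induction q with
  | zero => simp [mpow_one]
  | succ q ih =>
    rw [mpow_succ_succ, mpow_succ_succ, ih, hA.smul_mul, hA.mul_smul, smul_smul, ← pow_succ]

lemma mpow_add_mpow_le (hA : IsFAlgebra A) {m d : A} (hm : 0 ≤ m) (hd : 0 ≤ d) (q : ℕ) :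
    mpow m (q + 1) + mpow d (q + 1) ≤ mpow (m + d) (q + 1) := by
  have := hA.isOrderedAddMonoid
  induction q with
  | zero => rfl
  | succ q ih =>
    have hm' : 0 ≤ mpow m (q + 1) := hA.mulProd_nonneg fun _ => hm
    have hd' : 0 ≤ mpow d (q + 1) := hA.mulProd_nonneg fun _ => hd
    rw [mpow_succ_succ, mpow_succ_succ, mpow_succ_succ]
    refine le_trans ?_ (hA.mul_le_mul (add_nonneg hm' hd') ih (add_nonneg hm hd) le_rfl)
    simp only [hA.left_distrib, hA.right_distrib]
    exact add_le_add (le_add_of_nonneg_right (hA.mul_nonneg _ _ hd' hm))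
      (le_add_of_nonneg_left (hA.mul_nonneg _ _ hm' hd))

lemma mul_mpow_inf_eq_zero (hA : IsFAlgebra A) {d e m : A} (hde : d ⊓ e = 0) (hm : 0 ≤ m) (q : ℕ) :
    (d * mpow m (q + 1)) ⊓ e = 0 :=
  (hA.f_prop d e _ hde (hA.mulProd_nonneg fun _ => hm)).1

lemma mul_mpow_add (hA : IsFAlgebra A) {d e m : A} (hde : d ⊓ e = 0) (hm : 0 ≤ m) (q : ℕ) :
    d * mpow (m + e) (q + 1) = d * mpow m (q + 1) := by
  induction q with
  | zero => rw [mpow_one, mpow_one, hA.left_distrib, hA.mul_eq_zero_of_inf_eq_zero hde, add_zero]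
  | succ q ih =>
    rw [mpow_succ_succ, mpow_succ_succ, ← hA.mul_assoc, ih, hA.left_distrib,
      hA.mul_eq_zero_of_inf_eq_zero (hA.mul_mpow_inf_eq_zero hde hm q), add_zero, hA.mul_assoc]

lemma mul_mpow_comm (hA : IsFAlgebra A) (a : A) (q : ℕ) :
    a * mpow a (q + 1) = mpow a (q + 2) := by
  induction q with
  | zero => rfl
  | succ q ih => rw [mpow_succ_succ, ← hA.mul_assoc, ih, ← mpow_succ_succ]

/-- In a semiprime f-algebra, taking powers reflects the order on the positive cone. -/
lemma le_of_mpow_le_mpow (hA : IsFAlgebra A) (hsp : IsSemiprime A) {a b : A} (ha : 0 ≤ a)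
    (hb : 0 ≤ b) (q : ℕ) (h : mpow a (q + 1) ≤ mpow b (q + 1)) : a ≤ b := by
  have := hA.isOrderedAddMonoid
  have hde := posPart_inf_negPart_eq_zero (a - b)
  have hd := posPart_nonneg (a - b)
  have hm : 0 ≤ a ⊓ b := le_inf ha hb
  have ha' : a = a ⊓ b + (a - b)⁺ := by rw [inf_eq_sub_posPart_sub]; abel
  have hb' : b = a ⊓ b + (a - b)⁻ := by
    have := posPart_sub_negPart (a - b)
    rw [inf_eq_sub_posPart_sub, sub_add, this]; abel
  suffices (a - b)⁺ = 0 by simpa [posPart_eq_zero] using this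
  generalize (a - b)⁺ = d, (a - b)⁻ = e, a ⊓ b = m at *
  subst ha' hb'
  have hm' : 0 ≤ mpow m (q + 1) := hA.mulProd_nonneg fun _ => hm
  have hd' : 0 ≤ mpow d (q + 1) := hA.mulProd_nonneg fun _ => hd
  have key := hA.mul_le_mul hd le_rfl (add_nonneg hm' hd') ((hA.mpow_add_mpow_le hm hd q).trans h)
  rw [hA.mul_mpow_add hde hm, hA.left_distrib, add_le_iff_nonpos_right, hA.mul_mpow_comm] at key
  exact hsp d (q + 2) (by omega) (le_antisymm key (hA.mulProd_nonneg fun _ => hd))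

lemma isMajorant_of_mpow (hA : IsFAlgebra A) (hsp : IsSemiprime A) (q : ℕ) {g u : A} (hu : 0 ≤ u)
    (h : IsMajorantIn (piSet A (q + 1)) (mpow u (q + 1)) (mpow g (q + 1))) : IsMajorant u g := by
  have := hA.isOrderedAddMonoid
  refine ⟨hu, fun x => ?_⟩
  obtain ⟨c, hc, hcx⟩ := h.2 (mpow x (q + 1)) ⟨_, rfl⟩
  have hr : 0 < c ^ (((q + 1 : ℕ) : ℝ)⁻¹) := Real.rpow_pos_of_pos hc _
  refine ⟨c ^ (((q + 1 : ℕ) : ℝ)⁻¹), hr, fun n => ?_⟩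
  have hnn : 0 ≤ |x| ⊓ n • |g| := le_inf (abs_nonneg x) (nsmul_nonneg (abs_nonneg g) n)
  have hru := hA.smul_le_smul _ _ _ hr.le hu
  rw [smul_zero] at hru
  refine hA.le_of_mpow_le_mpow hsp hnn hru q ?_
  rw [hA.mpow_smul, Real.rpow_inv_natCast_pow hc.le q.succ_ne_zero]
  refine le_trans (le_inf ?_ ?_) (hcx (n ^ (q + 1)))
  · exact (hA.mulProd_le_mulProd (fun _ => hnn) fun _ => inf_le_left).trans_eq
      (hA.abs_mulProd q _).symm
  · refine (hA.mulProd_le_mulProd (fun _ => hnn) fun _ => inf_le_right).trans_eq ?_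
    rw [mpow, hA.abs_mulProd, ← Nat.cast_smul_eq_nsmul ℝ, ← Nat.cast_smul_eq_nsmul ℝ, Nat.cast_pow]
    exact hA.mpow_smul _ _ _

/-- Every `p`-fold product is dominated by the `p`-th power of a positive element. -/
lemma exists_le_mpow (hA : IsFAlgebra A) {q : ℕ} {w : A} (hw : w ∈ piSet A (q + 1)) :
    ∃ u : A, 0 ≤ u ∧ w ≤ mpow u (q + 1) := by
  have := hA.isOrderedAddMonoid
  obtain ⟨φ, rfl⟩ := hw
  refine ⟨∑ i, |φ i|, Finset.sum_nonneg fun i _ => abs_nonneg (φ i), (le_abs_self _).trans ?_⟩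
  rw [hA.abs_mulProd]
  exact hA.mulProd_le_mulProd (fun i => abs_nonneg _) fun i =>
    Finset.single_le_sum (f := fun i => |φ i|) (fun j _ => abs_nonneg _) (Finset.mem_univ i)

end IsFAlgebra

/-- In a semiprime uniformly complete f-algebra, if `g^p` is finite in
`Π_p(𝒜)`, then `g` is finite in `𝒜`; and if `u^p` (with `u ≥ 0`) is a majorant of `g^p` in
`Π_p(𝒜)`, then `u` is a majorant of `g` in `𝒜`. -/
theorem stmt13 {A : Type*} [Lattice A] [AddCommGroup A] [Module ℝ A] [Mul A]
    (hA : IsFAlgebra A) (hsp : IsSemiprime A) (huc : UniformlyComplete A)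
    (p : ℕ) (hp : 2 ≤ p) (g : A) :
    (IsFiniteEltIn (piSet A p) (mpow g p) → IsFiniteElt g) ∧
    (∀ u : A, 0 ≤ u → IsMajorantIn (piSet A p) (mpow u p) (mpow g p) → IsMajorant u g) := by
  obtain ⟨q, rfl⟩ : ∃ q, p = q + 1 := ⟨p - 1, by omega⟩
  refine ⟨fun ⟨w, hw, hw₀, h⟩ => ?_, fun u hu h => hA.isMajorant_of_mpow hsp q hu h⟩
  obtain ⟨u, hu, hwu⟩ := hA.exists_le_mpow hw
  refine ⟨u, hA.isMajorant_of_mpow hsp q hu ⟨hw₀.trans hwu, fun x hx => ?_⟩⟩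
  obtain ⟨c, hc, hcx⟩ := h x hx
  exact ⟨c, hc, fun n => (hcx n).trans (hA.smul_le_smul _ _ _ hc.le hwu)⟩

end FiniteElementsPaper
end

section
/- Let 𝒜 be a uniformly complete f-algebra and let p ∈ ℕ with p ≥ 2. If g₁, …, g_p are finite elements of 𝒜, then the product g₁⋯g_p is a finite element of the product algebra Π_p(𝒜). -/
namespace FiniteElementsPaper

variable {A : Type*} [Lattice A] [AddCommGroup A] [Module ℝ A]

section LatticeGroup

variable {A : Type*} [Lattice A] [AddCommGroup A] [IsOrderedAddMonoid A]

theorem inf_add_le_inf_add_inf {x y z : A} (hx : 0 ≤ x) (hy : 0 ≤ y) (hz : 0 ≤ z) :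
    x ⊓ (y + z) ≤ x ⊓ y + x ⊓ z := by
  rw [add_inf, inf_add, inf_add]
  refine le_inf (le_inf ?_ ?_) (le_inf ?_ ?_)
  · exact inf_le_left.trans (le_add_of_nonneg_left hx)
  · exact inf_le_left.trans (le_add_of_nonneg_left hy)
  · exact inf_le_left.trans (le_add_of_nonneg_right hz)
  · exact inf_le_right

theorem add_inf_eq_zero_s14 {x y t : A} (hx : 0 ≤ x) (hy : 0 ≤ y) (ht : 0 ≤ t)
    (hxt : x ⊓ t = 0) (hyt : y ⊓ t = 0) : (x + y) ⊓ t = 0 := by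
  refine le_antisymm ?_ (le_inf (add_nonneg hx hy) ht)
  have h := inf_add_le_inf_add_inf ht hx hy
  rwa [inf_comm t x, inf_comm t y, hxt, hyt, add_zero, inf_comm] at h

end LatticeGroup

theorem mulProd_succ {A : Type*} [Mul A] [Zero A] (q : ℕ) (φ : Fin (q + 2) → A) :
    mulProd (q + 2) φ = mulProd (q + 1) (fun i => φ i.castSucc) * φ (Fin.last (q + 1)) := by
  simp [mulProd, Fin.foldl_succ_last]

theorem mpow_succ {A : Type*} [Mul A] [Zero A] (q : ℕ) (a : A) :
    mpow a (q + 2) = mpow a (q + 1) * a :=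
  mulProd_succ q _

theorem mpow_one_s14 {A : Type*} [Mul A] [Zero A] (a : A) : mpow a 1 = a := by
  simp [mpow, mulProd]

section Algebra

variable [Mul A]

theorem IsLAlgebra.isOrderedAddMonoid (hA : IsLAlgebra A) : IsOrderedAddMonoid A where
  add_le_add_left a b h c := by
    simpa only [add_comm] using hA.add_le_add_left a b h c

/-- The non-unital ring underlying an ℓ-algebra. -/
abbrev IsLAlgebra.nonUnitalNonAssocRing (hA : IsLAlgebra A) : NonUnitalNonAssocRing A where
  left_distrib := hA.left_distrib
  right_distrib := hA.right_distrib
  zero_mul a := by simpa using hA.right_distrib 0 0 a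
  mul_zero a := by simpa using hA.left_distrib a 0 0

theorem IsLAlgebra.smul_nonneg (hA : IsLAlgebra A) {r : ℝ} {a : A} (hr : 0 ≤ r) (ha : 0 ≤ a) :
    0 ≤ r • a := by
  simpa using hA.smul_le_smul r 0 a hr ha

theorem IsLAlgebra.smul_le_smul_right (hA : IsLAlgebra A) {r s : ℝ} {a : A} (hrs : r ≤ s)
    (ha : 0 ≤ a) : r • a ≤ s • a := by
  have := hA.isOrderedAddMonoid
  have h := hA.smul_nonneg (sub_nonneg.2 hrs) ha
  rwa [sub_smul, sub_nonneg] at h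

theorem IsLAlgebra.mul_le_mul (hA : IsLAlgebra A) {a b c d : A} (ha : 0 ≤ a) (hd : 0 ≤ d)
    (hab : a ≤ b) (hcd : c ≤ d) : a * c ≤ b * d := by
  have := hA.isOrderedAddMonoid
  let := hA.nonUnitalNonAssocRing
  have h₁ := hA.mul_nonneg a (d - c) ha (sub_nonneg.2 hcd)
  have h₂ := hA.mul_nonneg (b - a) d (sub_nonneg.2 hab) hd
  rw [mul_sub, sub_nonneg] at h₁
  rw [sub_mul, sub_nonneg] at h₂
  exact h₁.trans h₂

theorem IsLAlgebra.mul_le_abs_mul_abs (hA : IsLAlgebra A) (a b : A) : a * b ≤ |a| * |b| := by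
  have := hA.isOrderedAddMonoid
  let := hA.nonUnitalNonAssocRing
  have h₁ := hA.mul_nonneg (|a| - a) (|b| + b) (sub_nonneg.2 (le_abs_self a))
    (neg_le_iff_add_nonneg.1 (neg_le_abs b))
  have h₂ := hA.mul_nonneg (|a| + a) (|b| - b) (neg_le_iff_add_nonneg.1 (neg_le_abs a))
    (sub_nonneg.2 (le_abs_self b))
  have h : 0 ≤ (2 : ℝ) • (|a| * |b| - a * b) := by
    rw [two_smul]
    convert add_nonneg h₁ h₂ using 1
    simp only [mul_add, mul_sub, add_mul, sub_mul]
    abel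
  have h' := hA.smul_nonneg (r := 1 / 2) (by norm_num) h
  rw [smul_smul] at h'
  norm_num at h'
  exact h'

theorem IsLAlgebra.abs_mul_le (hA : IsLAlgebra A) (a b : A) : |a * b| ≤ |a| * |b| := by
  have := hA.isOrderedAddMonoid
  let := hA.nonUnitalNonAssocRing
  refine abs_le'.2 ⟨hA.mul_le_abs_mul_abs a b, ?_⟩
  have h := hA.mul_le_abs_mul_abs (-a) b
  rwa [neg_mul, abs_neg] at h

theorem IsLAlgebra.mpow_nonneg (hA : IsLAlgebra A) {a : A} (ha : 0 ≤ a) (q : ℕ) :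
    0 ≤ mpow a (q + 1) := by
  induction q with
  | zero => rwa [mpow_one_s14]
  | succ q ih => exact mpow_succ q a ▸ hA.mul_nonneg _ _ ih ha

theorem IsLAlgebra.mpow_le_mpow (hA : IsLAlgebra A) {a b : A} (ha : 0 ≤ a) (hab : a ≤ b) (q : ℕ) :
    mpow a (q + 1) ≤ mpow b (q + 1) := by
  induction q with
  | zero => rwa [mpow_one_s14, mpow_one_s14]
  | succ q ih =>
    rw [mpow_succ, mpow_succ]
    exact hA.mul_le_mul (hA.mpow_nonneg ha q) (ha.trans hab) ih hab

theorem IsLAlgebra.smul_mpow (hA : IsLAlgebra A) (r : ℝ) (a : A) (q : ℕ) :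
    mpow (r • a) (q + 1) = r ^ (q + 1) • mpow a (q + 1) := by
  induction q with
  | zero => simp [mpow_one_s14]
  | succ q ih =>
    rw [mpow_succ, mpow_succ, ih, hA.smul_mul, hA.mul_smul, smul_smul, ← pow_succ]

theorem IsLAlgebra.abs_mulProd_le (hA : IsLAlgebra A) {h : A} (q : ℕ) (φ : Fin (q + 1) → A)
    (hφ : ∀ i, |φ i| ≤ h) : |mulProd (q + 1) φ| ≤ mpow h (q + 1) := by
  have := hA.isOrderedAddMonoid
  induction q with
  | zero => simpa [mpow, mulProd] using hφ 0
  | succ q ih =>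
    rw [mulProd_succ, mpow_succ]
    exact (hA.abs_mul_le _ _).trans (hA.mul_le_mul (abs_nonneg _)
      ((abs_nonneg _).trans (hφ 0)) (ih _ fun i => hφ i.castSucc) (hφ _))

/-- Adding `a` to the base changes a power only within the band generated by `a`. -/
theorem IsFAlgebra.exists_mpow_add (hA : IsFAlgebra A) {m a : A} (hm : 0 ≤ m) (ha : 0 ≤ a)
    (q : ℕ) : ∃ d : A, 0 ≤ d ∧ mpow (m + a) (q + 1) = mpow m (q + 1) + d ∧
      ∀ t : A, 0 ≤ t → a ⊓ t = 0 → d ⊓ t = 0 := by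
  have := hA.isOrderedAddMonoid
  induction q with
  | zero => exact ⟨a, ha, (mpow_one_s14 _).trans (by rw [mpow_one_s14]), fun _ _ h => h⟩
  | succ q ih =>
    obtain ⟨d, hd, hpow, hdisj⟩ := ih
    have hma := add_nonneg hm ha
    have hmq := hA.mpow_nonneg hm q
    have h₁ := hA.mul_nonneg _ _ hmq ha
    have h₂ := hA.mul_nonneg _ _ hd hma
    refine ⟨mpow m (q + 1) * a + d * (m + a), add_nonneg h₁ h₂, ?_, fun t ht hat => ?_⟩
    · rw [mpow_succ, mpow_succ, hpow, hA.right_distrib, hA.left_distrib, add_assoc]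
    · exact add_inf_eq_zero_s14 h₁ h₂ ht (hA.f_prop _ _ _ hat hmq).2
        (hA.f_prop _ _ _ (hdisj t ht hat) hma).1

theorem IsFAlgebra.mpow_inf_mpow_le (hA : IsFAlgebra A) {h k : A} (hh : 0 ≤ h) (hk : 0 ≤ k)
    (q : ℕ) : mpow h (q + 1) ⊓ mpow k (q + 1) ≤ mpow (h ⊓ k) (q + 1) := by
  have := hA.isOrderedAddMonoid
  have hm : 0 ≤ h ⊓ k := le_inf hh hk
  have ha : 0 ≤ h - h ⊓ k := sub_nonneg.2 inf_le_left
  have hb : 0 ≤ k - h ⊓ k := sub_nonneg.2 inf_le_right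
  have hab : (h - h ⊓ k) ⊓ (k - h ⊓ k) = 0 := by
    rw [sub_eq_add_neg, sub_eq_add_neg, ← inf_add, add_neg_cancel]
  obtain ⟨d, hd, hpd, hdisj⟩ := hA.exists_mpow_add hm ha q
  obtain ⟨e, he, hpe, hdisj'⟩ := hA.exists_mpow_add hm hb q
  have hde : d ⊓ e = 0 := by
    rw [inf_comm]
    exact hdisj' d hd (by rw [inf_comm]; exact hdisj _ hb hab)
  rw [add_sub_cancel] at hpd hpe
  rw [hpd, hpe, ← add_inf, hde, add_zero]

theorem IsLAlgebra.isMajorant_add (hA : IsLAlgebra A) {z w φ ψ : A} (hz : IsMajorant z φ)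
    (hw : IsMajorant w ψ) : IsMajorant (z + w) (|φ| + |ψ|) := by
  have := hA.isOrderedAddMonoid
  refine ⟨add_nonneg hz.1 hw.1, fun x => ?_⟩
  obtain ⟨c, hc, hcz⟩ := hz.2 x
  obtain ⟨d, hd, hdw⟩ := hw.2 x
  refine ⟨c + d, add_pos hc hd, fun n => ?_⟩
  rw [abs_of_nonneg (add_nonneg (abs_nonneg φ) (abs_nonneg ψ)), smul_add n, smul_add (c + d)]
  refine (inf_add_le_inf_add_inf (abs_nonneg x) (nsmul_nonneg (abs_nonneg φ) n)
    (nsmul_nonneg (abs_nonneg ψ) n)).trans (add_le_add ?_ ?_)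
  · exact (hcz n).trans (hA.smul_le_smul_right (le_add_of_nonneg_right hd.le) hz.1)
  · exact (hdw n).trans (hA.smul_le_smul_right (le_add_of_nonneg_left hc.le) hw.1)

theorem IsLAlgebra.exists_isFiniteElt_abs_le (hA : IsLAlgebra A) (p : ℕ) (g : Fin p → A)
    (hg : ∀ i, IsFiniteElt (g i)) : ∃ G : A, 0 ≤ G ∧ IsFiniteElt G ∧ ∀ i, |g i| ≤ G := by
  have := hA.isOrderedAddMonoid
  induction p with
  | zero =>
    exact ⟨0, le_rfl, ⟨0, le_rfl, fun x => ⟨1, one_pos, fun n => by simp⟩⟩, fun i => i.elim0⟩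
  | succ p ih =>
    obtain ⟨G, hG, ⟨z, hz⟩, hle⟩ := ih (fun i => g i.castSucc) fun i => hg _
    obtain ⟨w, hw⟩ := hg (Fin.last p)
    have hmaj := hA.isMajorant_add hz hw
    rw [abs_of_nonneg hG] at hmaj
    refine ⟨G + |g (Fin.last p)|, add_nonneg hG (abs_nonneg _), ⟨_, hmaj⟩, fun i => ?_⟩
    induction i using Fin.lastCases with
    | last => exact le_add_of_nonneg_left hG
    | cast i => exact (hle i).trans (le_add_of_nonneg_right (abs_nonneg _))

theorem IsLAlgebra.nsmul_mpow_le (hA : IsLAlgebra A) {a : A} (ha : 0 ≤ a) (n q : ℕ) :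
    n • mpow a (q + 1) ≤ mpow (n • a) (q + 1) := by
  rw [← Nat.cast_smul_eq_nsmul ℝ n a, hA.smul_mpow, ← Nat.cast_smul_eq_nsmul ℝ n]
  exact hA.smul_le_smul_right (by exact_mod_cast Nat.le_self_pow q.succ_ne_zero n)
    (hA.mpow_nonneg ha q)

end Algebra

/-- In a uniformly complete f-algebra, the product of finite elements
`g₁, …, g_p` is a finite element of `Π_p(𝒜)`. -/
theorem stmt14 {A : Type*} [Lattice A] [AddCommGroup A] [Module ℝ A] [Mul A]
    (hA : IsFAlgebra A) (huc : UniformlyComplete A) (p : ℕ) (hp : 2 ≤ p)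
    (g : Fin p → A) (hg : ∀ i, IsFiniteElt (g i)) :
    IsFiniteEltIn (piSet A p) (mulProd p g) := by
  have := hA.isOrderedAddMonoid
  obtain ⟨q, rfl⟩ : ∃ q, p = q + 1 := ⟨p - 1, by omega⟩
  obtain ⟨G, hG, ⟨z, hz, hmaj⟩, hle⟩ := hA.exists_isFiniteElt_abs_le _ g hg
  refine ⟨mpow z (q + 1), ⟨fun _ => z, rfl⟩, hA.mpow_nonneg hz q, ?_⟩
  rintro _ ⟨φ, rfl⟩
  have hφ : ∀ i, |φ i| ≤ ∑ j, |φ j| := fun i =>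
    Finset.single_le_sum (f := fun j => |φ j|) (fun j _ => abs_nonneg _) (Finset.mem_univ i)
  have hh : 0 ≤ ∑ j, |φ j| := (abs_nonneg _).trans (hφ 0)
  obtain ⟨c, hc, hcz⟩ := hmaj (∑ j, |φ j|)
  refine ⟨c ^ (q + 1), pow_pos hc _, fun n => ?_⟩
  have hnG : 0 ≤ n • G := nsmul_nonneg hG n
  have hcn := hcz n
  rw [abs_of_nonneg hh, abs_of_nonneg hG] at hcn
  calc |mulProd (q + 1) φ| ⊓ n • |mulProd (q + 1) g|
      ≤ mpow (∑ j, |φ j|) (q + 1) ⊓ mpow (n • G) (q + 1) :=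
        inf_le_inf (hA.abs_mulProd_le q φ hφ)
          ((nsmul_le_nsmul_right (hA.abs_mulProd_le q g hle) n).trans (hA.nsmul_mpow_le hG n q))
    _ ≤ mpow ((∑ j, |φ j|) ⊓ n • G) (q + 1) := hA.mpow_inf_mpow_le hh hnG q
    _ ≤ mpow (c • z) (q + 1) := hA.mpow_le_mpow (le_inf hh hnG) hcn q
    _ = c ^ (q + 1) • mpow z (q + 1) := hA.smul_mpow c z q

end FiniteElementsPaper
end
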